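/- Let k be a field of characteristic p > 0 with algebraic closure Ω, let k' ⊆ k'' be intermediate fields of Ω/k, both purely inseparable over k, and let R be a local Noetherian k-algebra. Then edim(R) ≤ edim(R ⊗_k k') ≤ edim(R ⊗_k k''). In particular, embedding jumps over purely inseparable extensions are nonnegative and monotone in the extension. -/

import Mathlib

open TensorProduct IsLocalRing

/-- The embedding dimension of a local ring: the dimension of the Zariski cotangent space
`m/m²` over the residue field. -/
noncomputable def edim (R : Type) [CommRing R] [IsLocalRing R] : ℕ :=
  Module.finrank (ResidueField R) (CotangentSpace R)


lemma edim_le_ncard {A : Type} [CommRing A] [IsLocalRing A] (s : Set A) (hs : s.Finite)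
    (h : Ideal.span s = maximalIdeal A) : edim A ≤ s.ncard := by
  have hfg : (maximalIdeal A).FG := by
    rw [← h]; exact Submodule.fg_span hs
  unfold edim
  rw [← spanFinrank_maximalIdeal_eq_finrank_cotangentSpace_of_fg hfg, ← h]
  exact Submodule.spanFinrank_span_le_ncard_of_finite hs

lemma exists_gens_edim (A : Type) [CommRing A] [IsLocalRing A] [IsNoetherianRing A] :
    ∃ s : Set A, s.Finite ∧ Ideal.span s = maximalIdeal A ∧ s.ncard = edim A := by
  have hfg : (maximalIdeal A).FG := (maximalIdeal A).fg_of_isNoetherianRing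
  refine ⟨(maximalIdeal A).generators, Submodule.FG.finite_generators hfg, Submodule.span_generators _, ?_⟩
  rw [Submodule.FG.generators_ncard hfg, spanFinrank_maximalIdeal_eq_finrank_cotangentSpace_of_fg hfg, edim]

lemma edim_le_of_equiv {A B : Type} [CommRing A] [IsLocalRing A] [CommRing B] [IsLocalRing B]
    [IsNoetherianRing B] (e : B ≃+* A) : edim A ≤ edim B := by
  obtain ⟨s, hf, hs, hc⟩ := exists_gens_edim B
  rw [← hc]
  refine le_trans (edim_le_ncard (e '' s) (hf.image _) ?_) (Set.ncard_image_le hf)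
  have h1 : Ideal.span (e '' s) = Ideal.map (e : B →+* A) (Ideal.span s) := by
    rw [Ideal.map_span]; rfl
  rw [h1, hs]
  have : (Ideal.map (e : B →+* A) (maximalIdeal B)).IsMaximal :=
    Ideal.map_isMaximal_of_equiv e
  exact IsLocalRing.eq_maximalIdeal this

/-- contraction property -/
def Contr {A B : Type} [CommRing A] [CommRing B] (f : A →+* B) : Prop :=
  ∀ I : Ideal A, (I.map f).comap f = I

lemma Contr.isLocalHom {A B : Type} [CommRing A] [CommRing B] {f : A →+* B} (hf : Contr f) :
    IsLocalHom f := by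
  constructor
  intro a ha
  have := hf (Ideal.span {a})
  rw [Ideal.map_span, Set.image_singleton, Ideal.span_singleton_eq_top.2 ha,
    Ideal.comap_top] at this
  exact Ideal.span_singleton_eq_top.1 this.symm

lemma contr_comp_equiv {A B C : Type} [CommRing A] [CommRing B] [CommRing C] {f : A →+* B}
    (hf : Contr f) (e : B ≃+* C) : Contr ((e : B →+* C).comp f) := by
  intro I
  rw [← Ideal.map_map, ← Ideal.comap_comap,
    Ideal.comap_map_of_bijective (e : B →+* C) e.bijective, hf]

lemma contr_includeRight (k K A : Type) [Field k] [Field K] [CommRing A] [Algebra k K]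
    [Algebra k A] :
    Contr (Algebra.TensorProduct.includeRight : A →ₐ[k] K ⊗[k] A).toRingHom := by
  have h1 : Contr (algebraMap A (A ⊗[k] K)) := fun I =>
    Ideal.comap_map_eq_self_of_faithfullyFlat I
  have := contr_comp_equiv h1 (Algebra.TensorProduct.comm k A K).toRingEquiv
  convert this using 1
  ext a
  simp

lemma edim_le_of_contr {A B : Type} [CommRing A] [CommRing B] [IsLocalRing A] [IsLocalRing B]
    [IsNoetherianRing B] (f : A →+* B) (hf : Contr f)
    (h : (maximalIdeal A).map f = maximalIdeal B) : edim A ≤ edim B := by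
  classical
  have hmem : ∀ a ∈ maximalIdeal A, f a ∈ maximalIdeal B := fun a ha => by
    rw [← h]; exact Ideal.mem_map_of_mem f ha
  let S : Set (maximalIdeal B) := {y | ∃ a ∈ maximalIdeal A, f a = y}
  have hS : Submodule.span B S = ⊤ := by
    apply Submodule.map_injective_of_injective (maximalIdeal B).injective_subtype
    rw [Submodule.map_top, Submodule.range_subtype, Submodule.map_span]
    refine Eq.trans ?_ h
    unfold Ideal.map Ideal.span
    congr 1
    ext y
    constructor
    · rintro ⟨y, ⟨a, ha, h⟩, rfl⟩
      exact ⟨a, ha, h⟩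
    · rintro ⟨a, ha, rfl⟩
      exact ⟨⟨f a, hmem a ha⟩, ⟨a, ha, rfl⟩, rfl⟩
  have hS' := CotangentSpace.span_image_eq_top_iff.2 hS
  obtain ⟨g, hg, hg2, -⟩ := Submodule.exists_fun_fin_finrank_span_eq (ResidueField B)
    ((maximalIdeal B).toCotangent '' S : Set (CotangentSpace B))
  choose y hyS hyg using hg
  choose a ha hay using hyS
  have hr : Module.finrank (ResidueField B) (Submodule.span (ResidueField B)
    ((maximalIdeal B).toCotangent '' S : Set (CotangentSpace B))) = edim B := by
    rw [hS', finrank_top]; rfl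
  have hspan : Submodule.span B (Set.range y) = ⊤ := by
    rw [← CotangentSpace.span_image_eq_top_iff, ← Set.range_comp]
    refine Eq.trans ?_ (hg2.trans hS')
    congr 2
    ext i
    exact hyg i
  have hm : Ideal.map f (Ideal.span (Set.range a)) = maximalIdeal B := by
    have := congrArg (Submodule.map (maximalIdeal B).subtype) hspan
    rw [Submodule.map_top, Submodule.range_subtype, Submodule.map_span] at this
    refine Eq.trans ?_ this
    rw [Ideal.map_span, ← Set.range_comp, ← Set.range_comp]
    unfold Ideal.span
    congr 2
    ext i
    exact hay i
  have hA : Ideal.span (Set.range a) = maximalIdeal A := by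
    rw [← hf (Ideal.span (Set.range a)), hm, ← h, hf]
  refine (edim_le_ncard _ (Set.finite_range a) hA).trans ?_
  rw [← Set.image_univ]
  refine (Set.ncard_image_le).trans ?_
  rw [Set.ncard_univ, Nat.card_eq_fintype_card, Fintype.card_fin, hr]

lemma edim_le_quot_add_one {A C : Type} [CommRing A] [IsLocalRing A] [CommRing C] [IsLocalRing C]
    [IsNoetherianRing C] (q : A →+* C) (hq : Function.Surjective q) (c : A)
    (hc : RingHom.ker q = Ideal.span {c}) : edim A ≤ edim C + 1 := by
  obtain ⟨s, hf, hs, hn⟩ := exists_gens_edim C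
  choose g hg using hq
  refine (edim_le_ncard (insert c (g '' s)) ((hf.image _).insert _) ?_).trans
    ((Set.ncard_insert_le _ _).trans (by have := Set.ncard_image_le (f := g) hf; omega))
  rw [Ideal.span_insert, ← hc]
  have hq : Function.Surjective q := fun x => ⟨g x, hg x⟩
  have h1 : Ideal.span s = Ideal.map q (Ideal.span (g '' s)) := by
    rw [Ideal.map_span, ← Set.image_comp]
    congr 1
    ext x
    simp [hg]
  have h2 := congrArg (Ideal.comap q) (hs.symm.trans h1)
  rw [Ideal.comap_map_of_surjective q hq] at h2
  have h3 : (maximalIdeal C).comap q = maximalIdeal A :=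
    IsLocalRing.eq_maximalIdeal (Ideal.comap_isMaximal_of_surjective q hq)
  rw [h3] at h2
  rw [h2, sup_comm]
  rfl

lemma edim_add_one_le {B C : Type} [CommRing B] [IsLocalRing B] [IsNoetherianRing B]
    [CommRing C] [IsLocalRing C] [IsNoetherianRing C] (f : B →+* C) (hf : Function.Surjective f)
    (g : B →+* DualNumber (ResidueField C))
    (hfg : ∀ b, (g b).fst = residue C (f b))
    (y : B) (hy : f y = 0) (hy' : (g y).snd = 1)
    (hz : ∀ z : C, ∃ b, f b = z ∧ (g b).snd = 0) :
    edim C + 1 ≤ edim B := by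
  classical
  have h3 : (maximalIdeal C).comap f = maximalIdeal B :=
    IsLocalRing.eq_maximalIdeal (Ideal.comap_isMaximal_of_surjective f hf)
  have hmem : ∀ b, b ∈ maximalIdeal B ↔ f b ∈ maximalIdeal C := by
    intro b; rw [← h3]; rfl
  obtain ⟨s, hsf, hs, hn⟩ := exists_gens_edim B
  have hsm : ∀ b ∈ s, f b ∈ maximalIdeal C := fun b hb => by
    rw [← hmem, ← hs]; exact Ideal.subset_span hb
  let V := CotangentSpace C × ResidueField C
  let φ : ∀ b : B, f b ∈ maximalIdeal C → V :=
    fun b hb => ((maximalIdeal C).toCotangent ⟨f b, hb⟩, (g b).snd)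
  let W : Submodule (ResidueField C) V :=
    Submodule.span _ (Set.range fun b : s => φ b.1 (hsm b.1 b.2))
  have key : ∀ b ∈ Ideal.span s, ∀ hb : f b ∈ maximalIdeal C, φ b hb ∈ W := by
    intro b hb
    induction hb using Submodule.span_induction with
    | mem x hx => intro _; exact Submodule.subset_span ⟨⟨x, hx⟩, rfl⟩
    | zero =>
      intro h
      convert W.zero_mem
      have : (⟨f 0, h⟩ : maximalIdeal C) = 0 := by ext; simp
      refine Prod.ext ?_ ?_
      · change (maximalIdeal C).toCotangent _ = 0
        rw [this, map_zero]
      · change (g 0).snd = 0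
        simp
    | add x x' hx hx' h h' =>
      intro hh
      replace hx : x ∈ maximalIdeal B := hs ▸ hx
      replace hx' : x' ∈ maximalIdeal B := hs ▸ hx'
      have := W.add_mem (h ((hmem _).1 hx)) (h' ((hmem _).1 hx'))
      convert this using 1
      refine Prod.ext ?_ ?_
      · change (maximalIdeal C).toCotangent _ =
          (maximalIdeal C).toCotangent _ + (maximalIdeal C).toCotangent _
        rw [← map_add]
        congr 1
        ext
        simp
      · change (g (x + x')).snd = (g x).snd + (g x').snd
        simp
    | smul t x hx h =>
      intro hh
      replace hx : x ∈ maximalIdeal B := hs ▸ hx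
      have hx' := (hmem _).1 hx
      have := W.smul_mem (residue C (f t)) (h hx')
      convert this using 1
      simp only [φ]
      congr 1
      · have : (⟨f (t • x), hh⟩ : maximalIdeal C) = f t • ⟨f x, hx'⟩ := by
          ext; simp
        rw [this, map_smul]
        exact (algebraMap_smul (ResidueField C) (f t) _).symm
      · have h0 : (g x).fst = 0 := by
          rw [hfg]; exact (residue_eq_zero_iff _).2 hx'
        simp [TrivSqZeroExt.snd_mul, h0, hfg]
  have hW : W = ⊤ := by
    rw [eq_top_iff]
    rintro ⟨u, v⟩ -
    obtain ⟨⟨z, hzm⟩, rfl⟩ := (maximalIdeal C).toCotangent_surjective u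
    obtain ⟨b, rfl, hb⟩ := hz z
    have e1 := key b (by rw [hs, hmem]; exact hzm) hzm
    have hy0 : f y ∈ maximalIdeal C := by rw [hy]; exact zero_mem _
    have e2 := key y (by rw [hs, hmem]; exact hy0) hy0
    have := W.add_mem e1 (W.smul_mem v e2)
    convert this using 1
    have h0 : (⟨f y, hy0⟩ : maximalIdeal C) = 0 := by ext; simp [hy]
    simp only [φ, h0, map_zero, hb, hy']
    refine Prod.ext ?_ ?_
    · change _ = _ + v • (0 : CotangentSpace C)
      simp
    · change v = 0 + v • 1
      simp
  have : Finite s := hsf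
  have hfin : Module.finrank (ResidueField C) V = edim C + 1 := by
    rw [Module.finrank_prod, Module.finrank_self]; rfl
  rw [← hfin, ← finrank_top, ← hW, ← hn]
  have : Fintype s := hsf.fintype
  refine (finrank_range_le_card (R := ResidueField C) _).trans ?_
  rw [← Nat.card_eq_fintype_card, Nat.card_coe_set_eq]

open Polynomial in
lemma edim_le_simple_one (p : ℕ) [Fact p.Prime] (k L A : Type) [Field k] [CharP k p] [Field L]
    [Algebra k L] [CommRing A] [IsLocalRing A] [IsNoetherianRing A] [Algebra k A]
    (pb : PowerBasis k L) (a : k)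
    (hmin : minpoly k pb.gen = X ^ p - C a)
    [IsLocalRing (L ⊗[k] A)] [IsNoetherianRing (L ⊗[k] A)]
    (b : A) (hb : algebraMap k A a - b ^ p ∈ maximalIdeal A) :
    edim A ≤ edim (L ⊗[k] A) := by
  have hp : p ≠ 0 := (Fact.out : p.Prime).ne_zero
  let c := algebraMap k A a - b ^ p
  let I : Ideal A := Ideal.span {c}
  have hI : I ≠ ⊤ := by
    intro h
    exact (maximalIdeal.isMaximal A).ne_top (top_le_iff.1 (h ▸ (Ideal.span_singleton_le_iff_mem _).2 hb))
  have : Nontrivial (A ⧸ I) := Ideal.Quotient.nontrivial_iff.2 hI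
  have : IsLocalRing (A ⧸ I) :=
    IsLocalRing.of_surjective' (Ideal.Quotient.mk I) Ideal.Quotient.mk_surjective
  let κ := ResidueField (A ⧸ I)
  let q : A →ₐ[k] A ⧸ I := Ideal.Quotient.mkₐ k I
  have hq : ∀ x, q x = Ideal.Quotient.mk I x := fun _ => rfl
  let r : A ⧸ I →ₐ[k] κ := IsScalarTower.toAlgHom k (A ⧸ I) κ
  let ι : κ →ₐ[k] DualNumber κ := TrivSqZeroExt.inlAlgHom k κ κ
  have h1 : (q b) ^ p = algebraMap k (A ⧸ I) a := by
    rw [← map_pow, ← q.commutes, eq_comm, hq, hq, Ideal.Quotient.eq]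
    exact Ideal.mem_span_singleton_self c
  have : CharP (DualNumber κ) p := charP_of_injective_algebraMap (algebraMap k _).injective p
  have hε : (DualNumber.eps : DualNumber κ) ^ p = 0 := by
    have : 2 ≤ p := (Fact.out : p.Prime).two_le
    refine pow_eq_zero_of_le this ?_
    rw [pow_two, DualNumber.eps_mul_eps]
  have h2 : (ι (r (q b)) + DualNumber.eps) ^ p = algebraMap k (DualNumber κ) a := by
    rw [add_pow_char, hε, add_zero, ← map_pow, ← map_pow, h1, AlgHom.commutes, AlgHom.commutes]
  let f1 : L →ₐ[k] A ⧸ I := pb.lift (q b) (by rw [hmin]; simp [h1])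
  let g1 : L →ₐ[k] DualNumber κ := pb.lift (ι (r (q b)) + DualNumber.eps)
    (by rw [hmin]; simp [h2])
  have hf1 : f1 pb.gen = q b := pb.lift_gen _ _
  have hg1 : g1 pb.gen = ι (r (q b)) + DualNumber.eps := pb.lift_gen _ _
  let f : L ⊗[k] A →ₐ[k] A ⧸ I := Algebra.TensorProduct.productMap f1 q
  let g : L ⊗[k] A →ₐ[k] DualNumber κ := Algebra.TensorProduct.productMap g1 ((ι.comp r).comp q)
  have hfg : (TrivSqZeroExt.fstHom k κ κ).comp g = r.comp f := by
    apply Algebra.TensorProduct.ext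
    · apply pb.algHom_ext
      simp [f, g, hf1, hg1, ι]
    · ext x
      simp [f, g, ι]
  have main := edim_add_one_le f.toRingHom (fun x => by
      obtain ⟨x, rfl⟩ := Ideal.Quotient.mk_surjective x
      exact ⟨1 ⊗ₜ x, by simp [f, hq]⟩) g.toRingHom (fun x => DFunLike.congr_fun hfg x)
      (pb.gen ⊗ₜ 1 - 1 ⊗ₜ b) (by simp [f, hf1]) (by simp [g, hg1, ι])
      (fun z => by
        obtain ⟨x, rfl⟩ := Ideal.Quotient.mk_surjective z
        exact ⟨1 ⊗ₜ x, by simp [f, hq], by simp [g, ι]⟩)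
  refine le_trans ?_ main
  exact edim_le_quot_add_one (Ideal.Quotient.mk I) Ideal.Quotient.mk_surjective c
    Ideal.mk_ker

open Polynomial in
lemma edim_le_simple_two (p : ℕ) [Fact p.Prime] (k L A : Type) [Field k] [CharP k p] [Field L]
    [Algebra k L] [CommRing A] [IsLocalRing A] [IsNoetherianRing A] [Algebra k A]
    (pb : PowerBasis k L) (a : k)
    (hmin : minpoly k pb.gen = X ^ p - C a)
    [IsLocalRing (L ⊗[k] A)] [IsNoetherianRing (L ⊗[k] A)]
    (hb : ∀ b : A, algebraMap k A a - b ^ p ∉ maximalIdeal A) :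
    edim A ≤ edim (L ⊗[k] A) := by
  have hx : pb.gen ^ p = algebraMap k L a := by
    have := minpoly.aeval k pb.gen
    rw [hmin] at this
    simpa [sub_eq_zero] using this
  let i : A →ₐ[k] L ⊗[k] A := Algebra.TensorProduct.includeRight
  have hc : Contr i.toRingHom := contr_includeRight k L A
  have hloc : IsLocalHom i.toRingHom := hc.isLocalHom
  refine edim_le_of_contr i.toRingHom hc ?_
  apply IsLocalRing.eq_maximalIdeal
  set J := (maximalIdeal A).map i.toRingHom with hJ
  have hJne : J ≠ ⊤ := by
    intro h
    have := hc (maximalIdeal A)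
    rw [← hJ, h, Ideal.comap_top] at this
    exact (maximalIdeal.isMaximal A).ne_top this.symm
  let κ := ResidueField A
  let F : κ[X] := X ^ p - C (residue A (algebraMap k A a))
  have hirr : Irreducible F := by
    apply X_pow_sub_C_irreducible_of_prime Fact.out
    intro b hb'
    obtain ⟨b, rfl⟩ := residue_surjective b
    apply hb b
    rw [← residue_eq_zero_iff, map_sub, map_pow, hb', sub_self]
  have : Fact (Irreducible F) := ⟨hirr⟩
  let Q := (L ⊗[k] A) ⧸ J
  let j : κ →+* Q := Ideal.Quotient.lift (maximalIdeal A) ((Ideal.Quotient.mk J).comp i.toRingHom)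
    (fun z hz => Ideal.Quotient.eq_zero_iff_mem.2 (Ideal.mem_map_of_mem _ hz))
  have hj : ∀ z : A, j (residue A z) = Ideal.Quotient.mk J (1 ⊗ₜ z) := fun z => rfl
  let ψ : AdjoinRoot F →+* Q := AdjoinRoot.lift j (Ideal.Quotient.mk J (pb.gen ⊗ₜ 1)) (by
    simp only [F, eval₂_sub, eval₂_pow, eval₂_X, eval₂_C]
    rw [hj, ← map_pow, ← map_sub, Algebra.TensorProduct.tmul_pow, hx, one_pow,
      Algebra.TensorProduct.tmul_one_eq_one_tmul, sub_self, map_zero])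
  have hψ : Function.Surjective ψ := by
    intro z
    obtain ⟨z, rfl⟩ := Ideal.Quotient.mk_surjective z
    induction z using TensorProduct.induction_on with
    | zero => exact ⟨0, by simp⟩
    | add x y hx hy =>
      obtain ⟨u, hu⟩ := hx
      obtain ⟨v, hv⟩ := hy
      exact ⟨u + v, by rw [map_add, map_add, hu, hv]⟩
    | tmul l z =>
      obtain ⟨P, hP⟩ := pb.exists_eq_aeval' l
      refine ⟨AdjoinRoot.mk F (P.map ((residue A).comp (algebraMap k A))) *
        AdjoinRoot.of F (residue A z), ?_⟩
      have e1 : (l ⊗ₜ z : L ⊗[k] A) = (l ⊗ₜ 1) * (1 ⊗ₜ z) := by simp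
      rw [e1, map_mul, map_mul, AdjoinRoot.lift_of, AdjoinRoot.lift_mk, hj]
      congr 1
      rw [hP, eval₂_map]
      have e2 : ((aeval pb.gen P) ⊗ₜ 1 : L ⊗[k] A) = aeval (pb.gen ⊗ₜ 1 : L ⊗[k] A) P :=
        (aeval_algHom_apply (Algebra.TensorProduct.includeLeft : L →ₐ[k] L ⊗[k] A) pb.gen P).symm
      rw [e2, aeval_def, hom_eval₂]
      congr 1
      ext t
      change j (residue A (algebraMap k A t)) = Ideal.Quotient.mk J (algebraMap k L t ⊗ₜ 1)
      rw [hj, Algebra.TensorProduct.tmul_one_eq_one_tmul]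
  have : Nontrivial Q := Ideal.Quotient.nontrivial_iff.2 hJne
  apply Ideal.Quotient.maximal_of_isField
  let e : AdjoinRoot F ≃+* Q := RingEquiv.ofBijective ψ ⟨ψ.injective, hψ⟩
  exact e.symm.toMulEquiv.isField (Field.toIsField _)

lemma isLocalRing_of_equiv' {A B : Type} [CommRing A] [CommRing B] [IsLocalRing A]
    (e : A ≃+* B) : IsLocalRing B :=
  haveI : Nontrivial B := e.injective.nontrivial
  IsLocalRing.of_surjective' (e : A →+* B) e.surjective

lemma exists_tower_map (k L K A : Type) [Field k] [Field L] [Field K] [Algebra k L] [Algebra k K]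
    [Algebra L K] [IsScalarTower k L K] [CommRing A] [Algebra k A] :
    ∃ f : L ⊗[k] A →+* K ⊗[k] A, Contr f ∧
      ∀ (l : L) (a : A), f (l ⊗ₜ a) = (algebraMap L K l) ⊗ₜ a := by
  let e := (Algebra.TensorProduct.cancelBaseChange k L L K A).toRingEquiv
  let i := (Algebra.TensorProduct.includeRight : _ →ₐ[L] K ⊗[L] (L ⊗[k] A)).toRingHom
  have hc0 : Contr i := contr_includeRight L K (L ⊗[k] A)
  refine ⟨(e : K ⊗[L] (L ⊗[k] A) →+* K ⊗[k] A).comp i, contr_comp_equiv hc0 e, ?_⟩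
  intro l a
  change Algebra.TensorProduct.cancelBaseChange k L L K A (1 ⊗ₜ (l ⊗ₜ a)) = _
  rw [Algebra.TensorProduct.cancelBaseChange_tmul, Algebra.smul_def, mul_one]

lemma isLocalRing_tower (k L K A : Type) [Field k] [Field L] [Field K] [Algebra k L] [Algebra k K]
    [Algebra L K] [IsScalarTower k L K] [CommRing A] [Algebra k A] [IsLocalRing (K ⊗[k] A)] :
    IsLocalRing (L ⊗[k] A) := by
  obtain ⟨f, hf, -⟩ := exists_tower_map k L K A
  have := hf.isLocalHom
  exact RingHom.domain_isLocalRing f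

lemma edim_tower (k L K A : Type) [Field k] [Field L] [Field K] [Algebra k L] [Algebra k K]
    [Algebra L K] [IsScalarTower k L K] [CommRing A] [Algebra k A] [IsLocalRing (K ⊗[k] A)]
    [IsNoetherianRing (K ⊗[k] A)] [IsLocalRing (L ⊗[k] A)] [IsNoetherianRing (L ⊗[k] A)]
    (H : ∀ (A' : Type) [CommRing A'] [IsLocalRing A'] [IsNoetherianRing A'] [Algebra L A']
      [IsLocalRing (K ⊗[L] A')] [IsNoetherianRing (K ⊗[L] A')], edim A' ≤ edim (K ⊗[L] A')) :
    edim (L ⊗[k] A) ≤ edim (K ⊗[k] A) := by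
  let e := (Algebra.TensorProduct.cancelBaseChange k L L K A).toRingEquiv
  have : IsLocalRing (K ⊗[L] (L ⊗[k] A)) := isLocalRing_of_equiv' e.symm
  have : IsNoetherianRing (K ⊗[L] (L ⊗[k] A)) := isNoetherianRing_of_ringEquiv _ e.symm
  exact (H (L ⊗[k] A)).trans (edim_le_of_equiv e.symm)

open Polynomial IntermediateField in
lemma edim_le_finite (p : ℕ) [Fact p.Prime] (n : ℕ) : ∀ (k K A : Type) [Field k] [CharP k p]
    [Field K] [Algebra k K] [CommRing A] [IsLocalRing A] [IsNoetherianRing A] [Algebra k A]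
    [FiniteDimensional k K] [IsPurelyInseparable k K]
    [IsLocalRing (K ⊗[k] A)] (_ : Module.finrank k K ≤ n), edim A ≤ edim (K ⊗[k] A) := by
  induction n with
  | zero =>
    intro k K A _ _ _ _ _ _ _ _ _ _ _ h
    have := Module.finrank_pos (R := k) (M := K)
    omega
  | succ n ih =>
    intro k K A _ _ _ _ _ _ _ _ _ _ _ hn
    have hN : ∀ (L : Type) [Field L] [Algebra k L] [FiniteDimensional k L],
        IsNoetherianRing (L ⊗[k] A) := by
      intro L _ _ _
      have : IsNoetherianRing (A ⊗[k] L) := IsNoetherianRing.of_finite A _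
      exact isNoetherianRing_of_ringEquiv _ (Algebra.TensorProduct.comm k A L).toRingEquiv
    have := hN K
    by_cases hsurj : Function.Surjective (algebraMap k K)
    · let e0 : k ≃ₐ[k] K := AlgEquiv.ofBijective (Algebra.ofId k K)
        ⟨(algebraMap k K).injective, hsurj⟩
      let e : K ⊗[k] A ≃ₐ[k] A :=
        (Algebra.TensorProduct.congr e0.symm AlgEquiv.refl).trans (Algebra.TensorProduct.lid k A)
      exact edim_le_of_equiv e.toRingEquiv
    · obtain ⟨y, hy⟩ : ∃ y, y ∉ (algebraMap k K).range := by
        by_contra! h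
        exact hsurj h
      have : ExpChar k p := ExpChar.prime Fact.out
      have hex := IsPurelyInseparable.pow_mem k p y
      classical
      obtain ⟨x, hx, a, hxa⟩ : ∃ x : K, x ∉ (algebraMap k K).range ∧ ∃ a, algebraMap k K a = x ^ p := by
        have hs := Nat.find_spec hex
        have hm := fun m => @Nat.find_min _ _ hex m
        rcases h : Nat.find hex with _ | m
        · rw [h] at hs; simp at hs; exact absurd hs (by simpa using hy)
        · rw [h] at hs
          obtain ⟨a, ha⟩ := hs
          refine ⟨y ^ p ^ m, hm m (by omega), a, ?_⟩
          rw [ha, pow_succ, pow_mul]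
      have : CharP K p := charP_of_injective_algebraMap (algebraMap k K).injective p
      have hirr : Irreducible (X ^ p - C a : k[X]) := by
        apply X_pow_sub_C_irreducible_of_prime Fact.out
        intro b hb
        apply hx
        refine ⟨b, ?_⟩
        apply frobenius_inj K p
        simp only [frobenius_def]
        rw [← hxa, ← hb, map_pow]
      have hmin : minpoly k x = X ^ p - C a := by
        symm
        apply minpoly.eq_of_irreducible_of_monic hirr
        · simp [hxa]
        · exact monic_X_pow_sub_C a (Fact.out : p.Prime).ne_zero
      let pb : PowerBasis k k⟮x⟯ := adjoin.powerBasis (IsIntegral.of_finite k x)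
      have hpb : minpoly k pb.gen = X ^ p - C a := by
        rw [← hmin]
        exact minpoly_gen k x
      have hNL := hN k⟮x⟯
      have hl2 : IsLocalRing (k⟮x⟯ ⊗[k] A) := isLocalRing_tower k k⟮x⟯ K A
      have step1 : edim A ≤ edim (k⟮x⟯ ⊗[k] A) := by
        by_cases hb : ∃ b : A, algebraMap k A a - b ^ p ∈ maximalIdeal A
        · obtain ⟨b, hb⟩ := hb
          exact edim_le_simple_one p k k⟮x⟯ A pb a hpb b hb
        · push Not at hb
          exact edim_le_simple_two p k k⟮x⟯ A pb a hpb hb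
      have : CharP k⟮x⟯ p := charP_of_injective_algebraMap (algebraMap k k⟮x⟯).injective p
      have : IsPurelyInseparable k⟮x⟯ K := IsPurelyInseparable.tower_top k k⟮x⟯ K
      have hfr : Module.finrank k⟮x⟯ K ≤ n := by
        have h1 := Module.finrank_mul_finrank k k⟮x⟯ K
        have h2 : Module.finrank k k⟮x⟯ = p := by
          rw [adjoin.finrank (IsIntegral.of_finite k x), hmin, natDegree_X_pow_sub_C]
        have h3 : 2 ≤ p := (Fact.out : p.Prime).two_le
        have h4 := Module.finrank_pos (R := k⟮x⟯) (M := K)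
        rw [h2] at h1
        nlinarith
      refine step1.trans (edim_tower k k⟮x⟯ K A ?_)
      intro A' _ _ _ _ _ _
      exact ih k⟮x⟯ K A' hfr

open IntermediateField in
lemma edim_le_general (p : ℕ) [Fact p.Prime] (k K A : Type) [Field k] [CharP k p]
    [Field K] [Algebra k K] [CommRing A] [IsLocalRing A] [IsNoetherianRing A] [Algebra k A]
    [IsPurelyInseparable k K]
    [IsLocalRing (K ⊗[k] A)] [IsNoetherianRing (K ⊗[k] A)] : edim A ≤ edim (K ⊗[k] A) := by
  obtain ⟨s, hsf, hs, -⟩ := exists_gens_edim (K ⊗[k] A)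
  obtain ⟨M, hM, hsM⟩ := TensorProduct.exists_finite_submodule_left_of_setFinite s hsf
  obtain ⟨t, ht⟩ := Module.Finite.iff_fg.1 hM
  let L : IntermediateField k K := IntermediateField.adjoin k (t : Set K)
  have hML : M ≤ Subalgebra.toSubmodule L.toSubalgebra := by
    rw [← ht, Submodule.span_le]
    exact IntermediateField.subset_adjoin k _
  have hfd : FiniteDimensional k L :=
    IntermediateField.finiteDimensional_adjoin (fun x _ => IsPurelyInseparable.isIntegral' k x)
  obtain ⟨f, hc, hf⟩ := exists_tower_map k L K A
  have hfl : IsLocalHom f := hc.isLocalHom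
  have hl : IsLocalRing (L ⊗[k] A) := RingHom.domain_isLocalRing f
  have hpi : IsPurelyInseparable k L := IsPurelyInseparable.tower_bot k L K
  have step1 := edim_le_finite p _ k L A le_rfl
  refine step1.trans (edim_le_of_contr f hc ?_)
  have hrange : ∀ z : M ⊗[k] A, ∃ w : L ⊗[k] A, f w = M.subtype.rTensor A z := by
    intro z
    induction z using TensorProduct.induction_on with
    | zero => exact ⟨0, by simp⟩
    | add x y hx hy =>
      obtain ⟨u, hu⟩ := hx
      obtain ⟨v, hv⟩ := hy
      exact ⟨u + v, by rw [map_add, map_add, hu, hv]⟩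
    | tmul m a => exact ⟨(⟨m, hML m.2⟩ : L) ⊗ₜ a, by rw [hf]; rfl⟩
  apply le_antisymm
  · exact ((IsLocalRing.local_hom_TFAE f).out 0 2).1 hfl
  · conv_lhs => rw [← hs]
    rw [Ideal.span_le]
    intro z hz
    obtain ⟨z', rfl⟩ := hsM hz
    obtain ⟨w, hw⟩ := hrange z'
    rw [← hw] at hz ⊢
    apply Ideal.mem_map_of_mem
    have : f w ∈ maximalIdeal (K ⊗[k] A) := hs ▸ Ideal.subset_span hz
    rw [mem_maximalIdeal, mem_nonunits_iff] at this ⊢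
    exact fun h => this (h.map f)

theorem edim_le_edim_tensor_of_le
    (p : ℕ) [Fact p.Prime]
    (k Ω : Type) [Field k] [Field Ω] [CharP k p] [Algebra k Ω] [IsAlgClosure k Ω]
    (k' k'' : IntermediateField k Ω) (hle : k' ≤ k'')
    [IsPurelyInseparable k k'] [IsPurelyInseparable k k'']
    (R : Type) [CommRing R] [IsLocalRing R] [IsNoetherianRing R] [Algebra k R]
    [IsLocalRing (R ⊗[k] k')] [IsNoetherianRing (R ⊗[k] k')]
    [IsLocalRing (R ⊗[k] k'')] [IsNoetherianRing (R ⊗[k] k'')] :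
    edim R ≤ edim (R ⊗[k] k') ∧ edim (R ⊗[k] k') ≤ edim (R ⊗[k] k'') := by
  let c' := (Algebra.TensorProduct.comm k R k').toRingEquiv
  let c'' := (Algebra.TensorProduct.comm k R k'').toRingEquiv
  have : IsLocalRing (k' ⊗[k] R) := isLocalRing_of_equiv' c'
  have : IsNoetherianRing (k' ⊗[k] R) := isNoetherianRing_of_ringEquiv _ c'
  refine ⟨(edim_le_general p k k' R).trans (edim_le_of_equiv c'), ?_⟩
  let _ : Algebra k' k'' := (IntermediateField.inclusion hle).toRingHom.toAlgebra
  have : IsScalarTower k k' k'' := IsScalarTower.of_algebraMap_eq (fun _ => rfl)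
  have : IsLocalRing (k'' ⊗[k] R) := isLocalRing_of_equiv' c''
  have : IsNoetherianRing (k'' ⊗[k] R) := isNoetherianRing_of_ringEquiv _ c''
  have : IsPurelyInseparable k' k'' := IsPurelyInseparable.tower_top k k' k''
  have : CharP k' p := charP_of_injective_algebraMap (algebraMap k k').injective p
  refine (edim_le_of_equiv c'.symm).trans (le_trans ?_ (edim_le_of_equiv c''))
  apply edim_tower k k' k'' R
  intro A' _ _ _ _ _ _
  exact edim_le_general p k' k'' A'
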